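/- For Re(γ) > 0 and Re(β) > -1 and ℓ ≥ k ≥ 0, the integral S^{γ,β}_{ℓ,k} = ∫₀¹ (1-y)^{γ-1} y^β P_ℓ^{(γ,β)}(2y-1) P_k^{(γ,β)}(2y-1) dy equals ((γ+1)_k / k!) · Γ(γ)Γ(β+ℓ+1)/Γ(β+γ+ℓ+1), where P_n^{(a,b)} denotes the Jacobi polynomial and (x)_k the Pochhammer symbol. -/

import Mathlib

open MeasureTheory Real

/-- The Jacobi polynomial `P_n^{(a,b)}(x)`, defined via its hypergeometric-type
finite sum representation. -/
noncomputable def jacobiP (n : ℕ) (a b x : ℝ) : ℝ :=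
  (Real.Gamma (a + n + 1) / (n.factorial * Real.Gamma (a + b + n + 1))) *
    ∑ m ∈ Finset.range (n + 1),
      (n.choose m : ℝ) * Real.Gamma (a + b + n + m + 1) / Real.Gamma (a + m + 1) *
        ((x - 1) / 2) ^ m

theorem Real.Gamma_add_nat_eq_ascPochhammer_mul {z : ℝ} (hz : 0 < z) (n : ℕ) :
    Real.Gamma (z + n) = (ascPochhammer ℝ n).eval z * Real.Gamma z := by
  induction n with
  | zero => simp
  | succ n ih =>
    have h : z + n ≠ 0 := by positivity
    rw [ascPochhammer_succ_eval, Nat.cast_succ, ← add_assoc, Real.Gamma_add_one h, ih]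
    ring

theorem ofReal_beta_integrand {u v y : ℝ} (hy : y ∈ Set.Icc (0 : ℝ) 1) :
    (((1 - y) ^ (u - 1) * y ^ (v - 1) : ℝ) : ℂ) =
      (y : ℂ) ^ ((v : ℂ) - 1) * (1 - (y : ℂ)) ^ ((u : ℂ) - 1) := by
  have h1 : 0 ≤ 1 - y := by linarith [hy.2]
  push_cast [Complex.ofReal_cpow hy.1, Complex.ofReal_cpow h1]
  ring

theorem intervalIntegrable_one_sub_rpow_mul_rpow {u v : ℝ} (hu : 0 < u) (hv : 0 < v) :
    IntervalIntegrable (fun y : ℝ ↦ (1 - y) ^ (u - 1) * y ^ (v - 1)) volume 0 1 := by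
  have h := Complex.betaIntegral_convergent (u := v) (v := u) (by simpa) (by simpa)
  rw [intervalIntegrable_iff] at h ⊢
  refine h.re.congr ((ae_restrict_iff' measurableSet_uIoc).2 (.of_forall fun y hy ↦ ?_))
  rw [Set.uIoc_of_le zero_le_one] at hy
  simp only [← ofReal_beta_integrand (Set.Ioc_subset_Icc_self hy)]
  exact Complex.ofReal_re _

theorem integral_one_sub_rpow_mul_rpow {u v : ℝ} (hu : 0 < u) (hv : 0 < v) :
    ∫ y in (0 : ℝ)..1, (1 - y) ^ (u - 1) * y ^ (v - 1) =
      Real.Gamma u * Real.Gamma v / Real.Gamma (u + v) := by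
  have h := Complex.betaIntegral_eq_Gamma_mul_div v u (by simpa) (by simpa)
  have e : Complex.betaIntegral v u =
      ((∫ y in (0 : ℝ)..1, (1 - y) ^ (u - 1) * y ^ (v - 1) : ℝ) : ℂ) := by
    rw [← intervalIntegral.integral_ofReal]
    refine intervalIntegral.integral_congr fun y hy ↦ ?_
    rw [Set.uIcc_of_le zero_le_one] at hy
    exact (ofReal_beta_integrand hy).symm
  rw [e, ← Complex.ofReal_add] at h
  simp only [Complex.Gamma_ofReal] at h
  rw [mul_comm (Real.Gamma u), add_comm u]
  exact_mod_cast h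

theorem sum_neg_one_pow_mul_choose_mul (f : ℝ → ℝ) (n : ℕ) (x : ℝ) :
    ∑ m ∈ Finset.range (n + 1), (-1 : ℝ) ^ m * n.choose m * f (x + m) =
      (-1) ^ n * (fwdDiff 1)^[n] f x := by
  rw [fwdDiff_iter_eq_sum_shift, Finset.mul_sum]
  refine Finset.sum_congr rfl fun m hm ↦ ?_
  have hm' : m ≤ n := Nat.lt_succ_iff.1 (Finset.mem_range.1 hm)
  have h : (-1 : ℝ) ^ n * (-1) ^ (n - m) = (-1) ^ m := by
    obtain ⟨k, rfl⟩ := Nat.exists_eq_add_of_le hm'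
    rw [Nat.add_sub_cancel_left, pow_add, mul_assoc, ← mul_pow]
    simp
  simp only [zsmul_eq_mul, nsmul_eq_mul, mul_one]
  push_cast
  rw [← h]
  ring

theorem sum_neg_one_pow_mul_choose_mul_eval {P : Polynomial ℝ} {n : ℕ} (hP : P.degree < n) :
    ∑ m ∈ Finset.range (n + 1), (-1 : ℝ) ^ m * n.choose m * P.eval (m : ℝ) = 0 := by
  rcases eq_or_ne P 0 with rfl | h0
  · simp
  have h := sum_neg_one_pow_mul_choose_mul P.eval n 0
  rw [P.fwdDiff_iter_eq_zero_of_degree_lt ((Polynomial.natDegree_lt_iff_degree_lt h0).2 hP)] at h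
  simpa using h

theorem fwdDiff_iter_inv (n : ℕ) {x : ℝ} (hx : 0 < x) :
    (fwdDiff 1)^[n] (fun y : ℝ ↦ y⁻¹) x =
      (-1) ^ n * n.factorial / (ascPochhammer ℝ (n + 1)).eval x := by
  induction n generalizing x with
  | zero => simp
  | succ n ih =>
    rw [Function.iterate_succ_apply', fwdDiff, ih hx, ih (by positivity)]
    have hp := ascPochhammer_pos n (x + 1) (by positivity)
    have e1 : (ascPochhammer ℝ (n + 1)).eval x = x * (ascPochhammer ℝ n).eval (x + 1) := by
      simp [ascPochhammer_succ_left]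
    have e2 : (ascPochhammer ℝ (n + 2)).eval x =
        x * ((ascPochhammer ℝ n).eval (x + 1) * (x + 1 + n)) := by
      rw [ascPochhammer_succ_left, Polynomial.eval_mul, Polynomial.eval_X, Polynomial.eval_comp,
        Polynomial.eval_add, Polynomial.eval_X, Polynomial.eval_one, ascPochhammer_succ_eval]
    rw [e1, e2, ascPochhammer_succ_eval]
    have : x + 1 + n ≠ 0 := by positivity
    push_cast [Nat.factorial_succ]
    field_simp
    ring

theorem sum_neg_one_pow_mul_choose_mul_eval_div {P : Polynomial ℝ} {n : ℕ} (hP : P.natDegree ≤ n)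
    {x : ℝ} (hx : 0 < x) :
    ∑ m ∈ Finset.range (n + 1), (-1 : ℝ) ^ m * n.choose m * (P.eval (m : ℝ) / (x + m)) =
      P.eval (-x) * n.factorial / (ascPochhammer ℝ (n + 1)).eval x := by
  set Q := P /ₘ (Polynomial.X - Polynomial.C (-x)) with hQ
  have hQd : Q.degree < n := by
    rcases eq_or_ne P 0 with rfl | h0
    · simp [hQ]
    · exact (Polynomial.degree_divByMonic_lt _ _ h0
        (by rw [Polynomial.degree_X_sub_C]; exact zero_lt_one)).trans_le (Polynomial.natDegree_le_iff_degree_le.1 hP)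
  have hPQ (y : ℝ) : P.eval y = P.eval (-x) + (x + y) * Q.eval y := by
    have h := congrArg (Polynomial.eval y)
      (Polynomial.modByMonic_add_div P (Polynomial.X - Polynomial.C (-x)))
    rw [Polynomial.modByMonic_X_sub_C_eq_C_eval] at h
    simp only [Polynomial.eval_add, Polynomial.eval_mul, Polynomial.eval_sub, Polynomial.eval_X,
      Polynomial.eval_C] at h
    rw [← h, ← hQ]
    ring
  have hI := sum_neg_one_pow_mul_choose_mul (fun y ↦ y⁻¹) n x
  rw [fwdDiff_iter_inv n hx] at hI
  calc _ = P.eval (-x) * (∑ m ∈ Finset.range (n + 1), (-1 : ℝ) ^ m * n.choose m * (x + m)⁻¹) +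
        ∑ m ∈ Finset.range (n + 1), (-1 : ℝ) ^ m * n.choose m * Q.eval (m : ℝ) := by
        rw [Finset.mul_sum, ← Finset.sum_add_distrib]
        refine Finset.sum_congr rfl fun m _ ↦ ?_
        have : x + m ≠ 0 := by positivity
        rw [hPQ m]
        field_simp
    _ = _ := by
        rw [hI, sum_neg_one_pow_mul_choose_mul_eval hQd, add_zero, mul_div_assoc, mul_div_assoc,
          ← mul_assoc ((-1 : ℝ) ^ n), ← mul_pow, neg_one_mul, neg_neg, one_pow, one_mul]

/-- The coefficient of `(1 - y) ^ m` in `P_n^{(a,b)}(2 y - 1)`. -/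
noncomputable def jacobiCoeff (n : ℕ) (a b : ℝ) (m : ℕ) : ℝ :=
  (Real.Gamma (a + n + 1) / (n.factorial * Real.Gamma (a + b + n + 1))) *
    ((-1) ^ m * n.choose m * (Real.Gamma (a + b + n + m + 1) / Real.Gamma (a + m + 1)))

theorem jacobiP_two_mul_sub_one (n : ℕ) (a b y : ℝ) :
    jacobiP n a b (2 * y - 1) =
      ∑ m ∈ Finset.range (n + 1), jacobiCoeff n a b m * (1 - y) ^ m := by
  rw [jacobiP, Finset.mul_sum]
  refine Finset.sum_congr rfl fun m _ ↦ ?_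
  rw [jacobiCoeff, show (2 * y - 1 - 1) / 2 = -1 * (1 - y) by ring, mul_pow]
  ring

theorem continuous_jacobiP (n : ℕ) (a b : ℝ) : Continuous (jacobiP n a b) := by
  unfold jacobiP
  fun_prop

theorem jacobiCoeff_zero {n : ℕ} {a b : ℝ} (ha : 0 < a) (hb : -1 < b) :
    jacobiCoeff n a b 0 = (ascPochhammer ℝ n).eval (a + 1) / n.factorial := by
  have h1 := (Real.Gamma_pos_of_pos (show 0 < a + b + n + 1 by
    linarith [(Nat.cast_nonneg n : (0 : ℝ) ≤ n)])).ne'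
  have h2 := (Real.Gamma_pos_of_pos (show 0 < a + 1 by positivity)).ne'
  have h3 := Real.Gamma_add_nat_eq_ascPochhammer_mul (show 0 < a + 1 by positivity) n
  rw [jacobiCoeff, show a + n + 1 = a + 1 + n by ring, h3]
  simp only [pow_zero, Nat.choose_zero_right, Nat.cast_one, Nat.cast_zero, add_zero]
  field_simp

theorem integral_jacobi_weight_mul_pow {γ β : ℝ} (hγ : 0 < γ) (hβ : -1 < β) (j : ℕ) :
    ∫ y in (0 : ℝ)..1, (1 - y) ^ (γ - 1) * y ^ β * (1 - y) ^ j =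
      Real.Gamma (γ + j) * Real.Gamma (β + 1) / Real.Gamma (γ + β + 1 + j) := by
  have h := integral_one_sub_rpow_mul_rpow (u := γ + j) (v := β + 1) (by positivity) (by linarith)
  rw [show γ + β + 1 + j = γ + j + (β + 1) by ring, ← h]
  refine intervalIntegral.integral_congr_Ioo_of_le zero_le_one fun y hy ↦ ?_
  have hy' : 0 < 1 - y := by linarith [hy.2]
  rw [add_sub_cancel_right, show γ + j - 1 = γ - 1 + j by ring, Real.rpow_add_natCast hy'.ne']
  ring

theorem intervalIntegrable_jacobi_weight_mul {γ β : ℝ} (hγ : 0 < γ) (hβ : -1 < β)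
    {f : ℝ → ℝ} (hf : Continuous f) :
    IntervalIntegrable (fun y ↦ (1 - y) ^ (γ - 1) * y ^ β * f y) volume 0 1 := by
  have h := intervalIntegrable_one_sub_rpow_mul_rpow hγ (show 0 < β + 1 by linarith)
  simp only [add_sub_cancel_right] at h
  exact h.mul_continuousOn hf.continuousOn

theorem integral_jacobi_weight_mul_mul_jacobiP {γ β a b : ℝ} (hγ : 0 < γ) (hβ : -1 < β) (n : ℕ)
    {f : ℝ → ℝ} (hf : Continuous f) :
    ∫ y in (0 : ℝ)..1, (1 - y) ^ (γ - 1) * y ^ β * f y * jacobiP n a b (2 * y - 1) =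
      ∑ m ∈ Finset.range (n + 1), jacobiCoeff n a b m *
        ∫ y in (0 : ℝ)..1, (1 - y) ^ (γ - 1) * y ^ β * ((1 - y) ^ m * f y) := by
  simp_rw [← intervalIntegral.integral_const_mul]
  rw [← intervalIntegral.integral_finsetSum fun m _ ↦
    (intervalIntegrable_jacobi_weight_mul hγ hβ (by fun_prop)).const_mul _]
  refine intervalIntegral.integral_congr fun y _ ↦ ?_
  simp only [jacobiP_two_mul_sub_one, Finset.mul_sum]
  exact Finset.sum_congr rfl fun m _ ↦ by ring

theorem integral_jacobi_weight_mul_pow_mul_jacobiP {γ β : ℝ} (hγ : 0 < γ) (hβ : -1 < β)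
    (n j : ℕ) :
    ∫ y in (0 : ℝ)..1, (1 - y) ^ (γ - 1) * y ^ β * (1 - y) ^ j * jacobiP n γ β (2 * y - 1) =
      Real.Gamma (γ + n + 1) / (n.factorial * Real.Gamma (γ + β + n + 1)) * Real.Gamma (β + 1) *
        ∑ m ∈ Finset.range (n + 1), (-1 : ℝ) ^ m * n.choose m *
          (Real.Gamma (γ + β + n + m + 1) / Real.Gamma (γ + β + m + j + 1) *
            (Real.Gamma (γ + m + j) / Real.Gamma (γ + m + 1))) := by
  rw [integral_jacobi_weight_mul_mul_jacobiP hγ hβ n (by fun_prop), Finset.mul_sum]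
  refine Finset.sum_congr rfl fun m _ ↦ ?_
  simp_rw [← pow_add]
  rw [integral_jacobi_weight_mul_pow hγ hβ, jacobiCoeff]
  push_cast
  rw [← add_assoc γ, show γ + β + 1 + (m + j) = γ + β + m + j + 1 by ring]
  ring

theorem integral_jacobi_weight_mul_pow_mul_jacobiP_eq_zero {γ β : ℝ} (hγ : 0 < γ) (hβ : -1 < β)
    {n j : ℕ} (hj : j < n) :
    ∫ y in (0 : ℝ)..1, (1 - y) ^ (γ - 1) * y ^ β * (1 - y) ^ (j + 1) *
      jacobiP n γ β (2 * y - 1) = 0 := by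
  obtain ⟨i, rfl⟩ := Nat.exists_eq_add_of_lt hj
  rw [integral_jacobi_weight_mul_pow_mul_jacobiP hγ hβ]
  let P : Polynomial ℝ :=
    (ascPochhammer ℝ i).comp (Polynomial.X + Polynomial.C (γ + β + j + 2)) *
      (ascPochhammer ℝ j).comp (Polynomial.X + Polynomial.C (γ + 1))
  have hP : P.degree < (j + i + 1 : ℕ) := by
    refine Polynomial.degree_le_natDegree.trans_lt (Nat.cast_lt.2 ?_)
    refine Polynomial.natDegree_mul_le.trans_lt ?_
    simp only [Polynomial.natDegree_comp, ascPochhammer_natDegree, Polynomial.natDegree_X_add_C]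
    omega
  rw [← mul_zero (Real.Gamma _ / _ * _), ← sum_neg_one_pow_mul_choose_mul_eval hP]
  congr 1
  refine Finset.sum_congr rfl fun m _ ↦ ?_
  have hm : (0 : ℝ) ≤ m := m.cast_nonneg
  have hj' : (0 : ℝ) ≤ j := j.cast_nonneg
  have p1 : 0 < (m : ℝ) + (γ + β + j + 2) := by linarith
  have p2 : 0 < (m : ℝ) + (γ + 1) := by linarith
  have h1 := Real.Gamma_add_nat_eq_ascPochhammer_mul p1 i
  have h2 := Real.Gamma_add_nat_eq_ascPochhammer_mul p2 j
  have n1 := (Real.Gamma_pos_of_pos p1).ne'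
  have n2 := (Real.Gamma_pos_of_pos p2).ne'
  push_cast
  rw [show γ + β + (j + i + 1) + m + 1 = m + (γ + β + j + 2) + i by ring,
    show γ + β + m + (j + 1) + 1 = m + (γ + β + j + 2) by ring,
    show γ + m + (j + 1) = m + (γ + 1) + j by ring,
    show γ + m + 1 = m + (γ + 1) by ring, h1, h2, mul_div_cancel_right₀ _ n1,
    mul_div_cancel_right₀ _ n2]
  simp [P, Polynomial.eval_comp]

theorem integral_jacobi_weight_mul_jacobiP {γ β : ℝ} (hγ : 0 < γ) (hβ : -1 < β) (n : ℕ) :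
    ∫ y in (0 : ℝ)..1, (1 - y) ^ (γ - 1) * y ^ β * jacobiP n γ β (2 * y - 1) =
      Real.Gamma γ * Real.Gamma (β + n + 1) / Real.Gamma (β + γ + n + 1) := by
  have h := integral_jacobi_weight_mul_pow_mul_jacobiP hγ hβ n 0
  simp only [pow_zero, mul_one, Nat.cast_zero, add_zero] at h
  let P : Polynomial ℝ :=
    (ascPochhammer ℝ n).comp (Polynomial.X + Polynomial.C (γ + β + 1))
  have hP : P.natDegree ≤ n := by
    simp only [P, Polynomial.natDegree_comp, ascPochhammer_natDegree, Polynomial.natDegree_X_add_C,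
      mul_one, le_refl]
  have hS := sum_neg_one_pow_mul_choose_mul_eval_div hP hγ
  have hterm : ∀ m : ℕ, Real.Gamma (γ + β + n + m + 1) / Real.Gamma (γ + β + m + 1) *
      (Real.Gamma (γ + m) / Real.Gamma (γ + m + 1)) = P.eval (m : ℝ) / (γ + m) := by
    intro m
    have hm : (0 : ℝ) ≤ m := m.cast_nonneg
    have p1 : 0 < (m : ℝ) + (γ + β + 1) := by linarith
    have p2 : 0 < γ + m := by linarith
    have n1 := (Real.Gamma_pos_of_pos p1).ne'
    have n2 := (Real.Gamma_pos_of_pos p2).ne'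
    rw [show γ + β + n + m + 1 = m + (γ + β + 1) + n by ring,
      show γ + β + m + 1 = m + (γ + β + 1) by ring, Real.Gamma_add_one p2.ne',
      Real.Gamma_add_nat_eq_ascPochhammer_mul p1, mul_div_cancel_right₀ _ n1]
    simp only [P, Polynomial.eval_comp, Polynomial.eval_add, Polynomial.eval_X, Polynomial.eval_C]
    field_simp
  simp_rw [hterm] at h
  have hPγ : P.eval (-γ) = (ascPochhammer ℝ n).eval (β + 1) := by
    simp only [P, Polynomial.eval_comp, Polynomial.eval_add, Polynomial.eval_X, Polynomial.eval_C]
    congr 1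
    ring
  have hn : (0 : ℝ) ≤ n := n.cast_nonneg
  have n3 := (Real.Gamma_pos_of_pos (show 0 < γ + β + n + 1 by linarith)).ne'
  have hg := Real.Gamma_add_nat_eq_ascPochhammer_mul hγ (n + 1)
  have hb := Real.Gamma_add_nat_eq_ascPochhammer_mul (show 0 < β + 1 by linarith) n
  have hp := (ascPochhammer_pos (n + 1) γ hγ).ne'
  push_cast at hg
  rw [← add_assoc] at hg
  rw [h, hS, hPγ, hg, show β + n + 1 = β + 1 + n by ring, hb, add_comm β γ]
  field_simp

/-- For `γ > 0`, `β > -1` and `ℓ ≥ k`, the integral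
`S^{γ,β}_{ℓ,k} = ∫₀¹ (1-y)^{γ-1} y^β P_ℓ^{(γ,β)}(2y-1) P_k^{(γ,β)}(2y-1) dy`
equals `((γ+1)_k / k!) · Γ(γ)Γ(β+ℓ+1)/Γ(β+γ+ℓ+1)`. -/
theorem S_integral_eval (β γ : ℝ) (hγ : 0 < γ) (hβ : -1 < β) (k ℓ : ℕ) (hkl : k ≤ ℓ) :
    (∫ y in (0:ℝ)..1, (1 - y) ^ (γ - 1) * y ^ β *
        jacobiP ℓ γ β (2 * y - 1) * jacobiP k γ β (2 * y - 1)) =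
      (ascPochhammer ℝ k).eval (γ + 1) / (k.factorial : ℝ) *
        (Real.Gamma γ * Real.Gamma (β + ℓ + 1) / Real.Gamma (β + γ + ℓ + 1)) := by
  rw [integral_jacobi_weight_mul_mul_jacobiP hγ hβ k
      (f := fun y ↦ jacobiP ℓ γ β (2 * y - 1)) ((continuous_jacobiP ℓ γ β).comp (by fun_prop)),
    Finset.sum_range_succ', Finset.sum_eq_zero, zero_add, jacobiCoeff_zero hγ hβ]
  · simp only [pow_zero, one_mul]
    rw [integral_jacobi_weight_mul_jacobiP hγ hβ]
  · intro i hi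
    have h := integral_jacobi_weight_mul_pow_mul_jacobiP_eq_zero hγ hβ
      ((Finset.mem_range.1 hi).trans_le hkl)
    simp only [mul_assoc] at h ⊢
    rw [h, mul_zero]
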